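/- Let a ∈ ℤ and let α ∈ K_∞ be nonzero with |α| = q^{2a+b}, where the integer b is nonzero. Then B_∞(ψ, a, α) := ∫_{|x| = q^a} ψ(α/x + x) dμ(x) equals: (q−1)·q^a if max(a+b, a) < −1; −q^a if max(a+b, a) = −1; and 0 if max(a+b, a) > −1. -/

import Mathlib

open Polynomial MeasureTheory
open scoped Classical

noncomputable section

variable (Fq : Type) [Field Fq] [Fintype Fq]

/-- `K_∞ = 𝔽_q((1/t))`, encoded as formal Laurent series in `X = t⁻¹`;
the coefficient of `t^{-i}` of `α` is `α.coeff i`. -/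
abbrev Kinf := LaurentSeries Fq

/-- The element `t ∈ K_∞` (i.e. `X⁻¹`). -/
def tK : Kinf Fq := HahnSeries.single (-1 : ℤ) 1

/-- The embedding `𝔽_q[t] → K_∞` sending `t` to `tK`. -/
def polyToK : Polynomial Fq →+* Kinf Fq := Polynomial.eval₂RingHom HahnSeries.C (tK Fq)

/-- The absolute value at infinity on `K_∞`: `|α| = q^{deg α}`, `|0| = 0`. -/
def absK (α : Kinf Fq) : ℝ :=
  if α = 0 then 0 else (Fintype.card Fq : ℝ) ^ (-(HahnSeries.order α))

/-- The additive character `e_q(a) = exp(2πi·tr(a)/p)` of `𝔽_q`. -/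
def eFq (a : Fq) : ℂ :=
  letI : Algebra (ZMod (ringChar Fq)) Fq := ZMod.algebra _ _
  Complex.exp (2 * Real.pi * Complex.I *
    (((ZMod.val (Algebra.trace (ZMod (ringChar Fq)) Fq a)) : ℂ) / (ringChar Fq : ℂ)))

/-- The additive character `ψ : K_∞ → ℂ`, `ψ(α) = e_q(a_{-1})`. -/
def psiK (α : Kinf Fq) : ℂ := eFq Fq (α.coeff 1)

/-- The Borel σ-algebra of `K_∞`, generated by the metric balls. -/
def KinfMS : MeasurableSpace (Kinf Fq) :=
  MeasurableSpace.generateFrom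
    {s : Set (Kinf Fq) | ∃ (a : Kinf Fq) (n : ℤ),
      s = {x | absK Fq (x - a) < (Fintype.card Fq : ℝ) ^ n}}

/-- `μ` is the additive Haar measure on `K_∞` normalized by `μ(𝕋) = 1`:
it is translation invariant and gives the unit ball measure `1`. -/
def IsHaar (μ : @Measure (Kinf Fq) (KinfMS Fq)) : Prop :=
  (∀ (a : Kinf Fq) (s : Set (Kinf Fq)), μ ((a + ·) ⁻¹' s) = μ s) ∧
    μ {x : Kinf Fq | absK Fq x < 1} = 1

end

noncomputable section

section Auxiliary

variable {Fq : Type} [Field Fq] [Fintype Fq]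

attribute [local instance] KinfMS

/-! ### The additive character `eFq` -/

theorem eFq_eq_stdAddChar_trace {Fq : Type} [Field Fq] [NeZero (ringChar Fq)]
    [Algebra (ZMod (ringChar Fq)) Fq] (a : Fq) :
    eFq Fq a = ZMod.stdAddChar (Algebra.trace (ZMod (ringChar Fq)) Fq a) := by
  rw [ZMod.stdAddChar_apply, ZMod.toCircle_apply, eFq]
  have := Subsingleton.elim (ZMod.algebra Fq (ringChar Fq)) ‹Algebra (ZMod (ringChar Fq)) Fq›
  subst this
  congr 1
  ring

/-- `eFq` is the value of a nontrivial additive character. -/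
theorem exists_addChar_eq_eFq :
    ∃ χ : AddChar Fq ℂ, χ ≠ 1 ∧ ∀ a, eFq Fq a = χ a := by
  have : Fact (ringChar Fq).Prime := ⟨CharP.char_is_prime Fq _⟩
  have : NeZero (ringChar Fq) := ⟨(Fact.out : (ringChar Fq).Prime).ne_zero⟩
  let _ : Algebra (ZMod (ringChar Fq)) Fq := ZMod.algebra _ _
  refine ⟨ZMod.stdAddChar.compAddMonoidHom
    (Algebra.trace (ZMod (ringChar Fq)) Fq).toAddMonoidHom, ?_, eFq_eq_stdAddChar_trace⟩
  obtain ⟨b, hb⟩ := FiniteField.trace_to_zmod_nondegenerate Fq one_ne_zero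
  rw [one_mul] at hb
  refine AddChar.ne_one_iff.2 ⟨b, fun h ↦ hb ?_⟩
  exact ZMod.injective_stdAddChar (h.trans (AddChar.map_zero_eq_one _).symm)

theorem eFq_zero : eFq Fq 0 = 1 := by
  obtain ⟨χ, -, hχ⟩ := exists_addChar_eq_eFq (Fq := Fq)
  simp [hχ]

theorem eFq_add (a b : Fq) : eFq Fq (a + b) = eFq Fq a * eFq Fq b := by
  obtain ⟨χ, -, hχ⟩ := exists_addChar_eq_eFq (Fq := Fq)
  simp [hχ, AddChar.map_add_eq_mul]

theorem sum_eFq : ∑ c, eFq Fq c = 0 := by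
  obtain ⟨χ, h, hχ⟩ := exists_addChar_eq_eFq (Fq := Fq)
  simpa [hχ] using AddChar.sum_eq_zero_of_ne_one h

theorem sum_eFq_mul {d : Fq} (hd : d ≠ 0) : ∑ c, eFq Fq (c * d) = 0 := by
  rw [← sum_eFq (Fq := Fq)]
  exact Equiv.sum_comp (Equiv.mulRight₀ d hd) (eFq Fq)

theorem sum_eFq_erase_zero : ∑ c ∈ Finset.univ.erase 0, eFq Fq c = -1 := by
  have h := Finset.add_sum_erase Finset.univ (eFq Fq) (Finset.mem_univ 0)
  rw [sum_eFq, eFq_zero] at h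
  exact (neg_eq_of_add_eq_zero_right h).symm

theorem sum_eFq_div_erase_zero {d : Fq} (hd : d ≠ 0) :
    ∑ c ∈ Finset.univ.erase 0, eFq Fq (d / c) = -1 := by
  rw [← sum_eFq_erase_zero (Fq := Fq)]
  exact Finset.sum_bij' (fun c _ ↦ d / c) (fun c _ ↦ d / c) (by simp [hd]) (by simp [hd])
    (by simp [hd]) (by simp [hd]) (by simp)

/-! ### The absolute value in terms of coefficients -/

theorem one_lt_card_real : (1 : ℝ) < Fintype.card Fq := by exact_mod_cast Fintype.one_lt_card

theorem card_pos_real : (0 : ℝ) < Fintype.card Fq := zero_lt_one.trans one_lt_card_real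

theorem absK_eq_zpow_iff {x : Kinf Fq} {n : ℤ} :
    absK Fq x = (Fintype.card Fq : ℝ) ^ n ↔ x ≠ 0 ∧ x.order = -n := by
  have hq := one_lt_card_real (Fq := Fq)
  by_cases hx : x = 0
  · simp [absK, hx, (zpow_pos card_pos_real n).ne]
  · rw [absK, if_neg hx, zpow_right_inj₀ card_pos_real hq.ne']
    simp only [ne_eq, hx, not_false_eq_true, true_and]
    omega

theorem order_eq_iff_coeff {Fq : Type} [Field Fq] {x : Kinf Fq} {m : ℤ} :
    (x ≠ 0 ∧ x.order = m) ↔ x.coeff m ≠ 0 ∧ ∀ i < m, x.coeff i = 0 := by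
  constructor
  · rintro ⟨hx, rfl⟩
    exact ⟨mt HahnSeries.coeff_order_eq_zero.1 hx,
      fun i hi ↦ HahnSeries.coeff_eq_zero_of_lt_order hi⟩
  · rintro ⟨h, h'⟩
    have hx : x ≠ 0 := by rintro rfl; simp at h
    exact ⟨hx, le_antisymm (HahnSeries.order_le_of_coeff_ne_zero h)
      ((HahnSeries.le_order_iff_forall hx).2 h')⟩

theorem absK_eq_zpow_iff_coeff {x : Kinf Fq} {n : ℤ} :
    absK Fq x = (Fintype.card Fq : ℝ) ^ n ↔ x.coeff (-n) ≠ 0 ∧ ∀ i < -n, x.coeff i = 0 :=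
  absK_eq_zpow_iff.trans order_eq_iff_coeff

theorem absK_lt_zpow_iff_coeff {x : Kinf Fq} {n : ℤ} :
    absK Fq x < (Fintype.card Fq : ℝ) ^ n ↔ ∀ i ≤ -n, x.coeff i = 0 := by
  have hq := one_lt_card_real (Fq := Fq)
  by_cases hx : x = 0
  · simp [absK, hx, zpow_pos card_pos_real n]
  · rw [absK, if_neg hx, zpow_lt_zpow_iff_right₀ hq]
    constructor
    · exact fun h i hi ↦ HahnSeries.coeff_eq_zero_of_lt_order (by omega)
    · intro h
      by_contra! h'
      exact hx (HahnSeries.coeff_order_eq_zero.1 (h _ (by omega)))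

/-! ### Balls and spheres -/

variable (Fq) in
/-- The sphere `|x| = q^a`. -/
def sphereK (a : ℤ) : Set (Kinf Fq) := {x | absK Fq x = (Fintype.card Fq : ℝ) ^ a}

/-- The open ball `|x - y| < q^n`. -/
def ballK (y : Kinf Fq) (n : ℤ) : Set (Kinf Fq) :=
  {x | absK Fq (x - y) < (Fintype.card Fq : ℝ) ^ n}

theorem mem_ballK {x y : Kinf Fq} {n : ℤ} :
    x ∈ ballK y n ↔ ∀ i ≤ -n, x.coeff i = y.coeff i := by
  simp [ballK, absK_lt_zpow_iff_coeff, sub_eq_zero]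

theorem mem_sphereK {x : Kinf Fq} {a : ℤ} :
    x ∈ sphereK Fq a ↔ x.coeff (-a) ≠ 0 ∧ ∀ i < -a, x.coeff i = 0 :=
  absK_eq_zpow_iff_coeff

theorem measurableSet_ballK (y : Kinf Fq) (n : ℤ) : MeasurableSet (ballK y n) :=
  MeasurableSpace.measurableSet_generateFrom ⟨y, n, rfl⟩

theorem mem_ballK_single {x : Kinf Fq} {n : ℤ} {c : Fq} :
    x ∈ ballK (HahnSeries.single (-n) c) n ↔ x.coeff (-n) = c ∧ ∀ i < -n, x.coeff i = 0 := by
  rw [mem_ballK]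
  constructor
  · intro h
    refine ⟨by simpa using h _ le_rfl, fun i hi ↦ ?_⟩
    simpa [HahnSeries.coeff_single_of_ne hi.ne] using h i hi.le
  · rintro ⟨h, h'⟩ i hi
    rcases hi.eq_or_lt with rfl | hi
    · simpa using h
    · rw [h' i hi, HahnSeries.coeff_single_of_ne hi.ne]

theorem pairwise_disjoint_ballK_single (n : ℤ) :
    Pairwise fun c d : Fq ↦
      Disjoint (ballK (HahnSeries.single (-n) c) n) (ballK (HahnSeries.single (-n) d) n) := by
  refine fun c d hcd ↦ Set.disjoint_left.2 fun x hc hd ↦ hcd ?_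
  rw [mem_ballK_single] at hc hd
  exact hc.1.symm.trans hd.1

theorem ballK_zero_succ (n : ℤ) :
    ballK (0 : Kinf Fq) (n + 1) =
      ⋃ c ∈ (Finset.univ : Finset Fq), ballK (HahnSeries.single (-n) c) n := by
  ext x
  simp only [mem_ballK, HahnSeries.coeff_zero, Finset.mem_univ, Set.iUnion_true, Set.mem_iUnion]
  simp only [← mem_ballK, mem_ballK_single, exists_eq_left']
  exact forall_congr' fun i ↦ ⟨fun h hi ↦ h (by omega), fun h hi ↦ h (by omega)⟩

theorem sphereK_eq_biUnion (a : ℤ) :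
    sphereK Fq a = ⋃ c ∈ Finset.univ.erase (0 : Fq), ballK (HahnSeries.single (-a) c) a := by
  ext x
  simp [mem_sphereK, mem_ballK_single]

theorem measurableSet_sphereK (a : ℤ) : MeasurableSet (sphereK Fq a) := by
  rw [sphereK_eq_biUnion]
  exact Finset.measurableSet_biUnion _ fun c _ ↦ measurableSet_ballK _ _

/-! ### Haar measure of balls -/

theorem measurable_const_add_Kinf (h : Kinf Fq) : Measurable (h + · : Kinf Fq → Kinf Fq) := by
  refine measurable_generateFrom ?_
  rintro _ ⟨y, n, rfl⟩
  convert measurableSet_ballK (y - h) n using 1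
  ext x
  simp only [ballK, Set.mem_preimage, Set.mem_ofPred_eq]
  congr! 2
  ring

theorem preimage_const_add_ballK (h : Kinf Fq) (n : ℤ) :
    (h + ·) ⁻¹' ballK h n = ballK 0 n := by
  ext x
  simp [ballK]

variable {μ : Measure (Kinf Fq)}

theorem IsHaar.ballK_eq (hμ : IsHaar Fq μ) (y : Kinf Fq) (n : ℤ) :
    μ (ballK y n) = μ (ballK 0 n) := by
  rw [← preimage_const_add_ballK y, hμ.1]

theorem IsHaar.ballK_zero_succ (hμ : IsHaar Fq μ) (n : ℤ) :
    μ (ballK 0 (n + 1)) = Fintype.card Fq * μ (ballK 0 n) := by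
  rw [_root_.ballK_zero_succ, measure_biUnion_finset
    (fun c _ d _ h ↦ pairwise_disjoint_ballK_single n h) fun c _ ↦ measurableSet_ballK _ _]
  simp [hμ.ballK_eq]

theorem IsHaar.measureReal_ballK (hμ : IsHaar Fq μ) (y : Kinf Fq) (n : ℤ) :
    μ.real (ballK y n) = (Fintype.card Fq : ℝ) ^ n := by
  have hq := (card_pos_real (Fq := Fq)).ne'
  have hsucc (m : ℤ) : μ.real (ballK 0 (m + 1)) = Fintype.card Fq * μ.real (ballK 0 m) := by
    simp [measureReal_def, hμ.ballK_zero_succ]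
  rw [measureReal_def, hμ.ballK_eq, ← measureReal_def]
  induction n with
  | zero =>
    have h : ballK (0 : Kinf Fq) 0 = {x | absK Fq x < 1} := by simp [ballK]
    simp [measureReal_def, h, hμ.2]
  | succ n ih => rw [hsucc, ih, zpow_add_one₀ hq, mul_comm]
  | pred n ih =>
    have := hsucc (-n - 1)
    rw [sub_add_cancel, ih] at this
    rw [zpow_sub_one₀ hq, this]
    field_simp

theorem IsHaar.ballK_ne_top (hμ : IsHaar Fq μ) (y : Kinf Fq) (n : ℤ) : μ (ballK y n) ≠ ⊤ := by
  intro h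
  have := hμ.measureReal_ballK y n
  rw [measureReal_def, h] at this
  exact (zpow_pos card_pos_real n).ne this

theorem IsHaar.measurePreserving_const_add (hμ : IsHaar Fq μ) (h : Kinf Fq) :
    MeasurePreserving (h + ·) μ μ :=
  ⟨measurable_const_add_Kinf h, Measure.ext fun s hs ↦ by
    rw [Measure.map_apply (measurable_const_add_Kinf h) hs, hμ.1]⟩

/-- Translation by `h` as a measurable equivalence. -/
def constAddKinf (h : Kinf Fq) : Kinf Fq ≃ᵐ Kinf Fq where
  toEquiv := Equiv.addLeft h
  measurable_toFun := measurable_const_add_Kinf h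
  measurable_invFun := measurable_const_add_Kinf (-h)

/-! ### Integrals over spheres -/

/-- A function on the sphere `|x| = q^a` that only depends on the leading coefficient. -/
theorem IsHaar.setIntegral_sphereK_of_leadingCoeff (hμ : IsHaar Fq μ) {a : ℤ} {f : Kinf Fq → ℂ}
    {g : Fq → ℂ} (hfg : ∀ x ∈ sphereK Fq a, f x = g (x.coeff (-a))) :
    ∫ x in sphereK Fq a, f x ∂μ = (∑ c ∈ Finset.univ.erase 0, g c) * (Fintype.card Fq : ℂ) ^ a := by
  have hball (c : Fq) (hc : c ∈ Finset.univ.erase 0) :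
      Set.EqOn f (fun _ ↦ g c) (ballK (HahnSeries.single (-a) c) a) := by
    intro x hx
    rw [mem_ballK_single] at hx
    have hx' : x ∈ sphereK Fq a := mem_sphereK.2 ⟨hx.1 ▸ Finset.ne_of_mem_erase hc, hx.2⟩
    rw [hfg x hx', hx.1]
  have hm (c : Fq) := measurableSet_ballK (HahnSeries.single (-a) c) a
  rw [sphereK_eq_biUnion, integral_biUnion_finset _ (fun c _ ↦ hm c)
    (fun c _ d _ h ↦ pairwise_disjoint_ballK_single a h), Finset.sum_mul]
  · refine Finset.sum_congr rfl fun c hc ↦ ?_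
    rw [setIntegral_congr_fun (hm c) (hball c hc), setIntegral_const, hμ.measureReal_ballK,
      Complex.real_smul, mul_comm]
    push_cast
    rfl
  · exact fun c hc ↦ (integrableOn_const (hμ.ballK_ne_top _ _)).congr_fun (hball c hc).symm (hm c)

/-- If translating by the elements of a finite family preserves `s` and multiplies `f` by factors
that sum to zero, then `f` has integral zero over `s`. -/
theorem IsHaar.setIntegral_eq_zero_of_sum_translate (hμ : IsHaar Fq μ) {s : Set (Kinf Fq)}
    (hs : MeasurableSet s) {f : Kinf Fq → ℂ} {h : Fq → Kinf Fq} {w : Kinf Fq → Fq → ℂ}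
    (hh : ∀ c x, h c + x ∈ s ↔ x ∈ s) (hf : ∀ x ∈ s, ∀ c, f (h c + x) = f x * w x c)
    (hw : ∀ x ∈ s, ∑ c, w x c = 0) : ∫ x in s, f x ∂μ = 0 := by
  by_cases hint : IntegrableOn f s μ
  swap
  · exact integral_undef hint
  have hpre (c : Fq) : (h c + ·) ⁻¹' s = s := Set.ext (hh c)
  have hmp (c : Fq) := hμ.measurePreserving_const_add (h c)
  have hemb (c : Fq) : MeasurableEmbedding (h c + · : Kinf Fq → Kinf Fq) :=
    (constAddKinf (h c)).measurableEmbedding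
  have htrans (c : Fq) : ∫ x in s, f (h c + x) ∂μ = ∫ x in s, f x ∂μ := by
    have := (hmp c).setIntegral_preimage_emb (hemb c) f s
    rwa [hpre] at this
  have hint' (c : Fq) : IntegrableOn (fun x ↦ f (h c + x)) s μ := by
    have := ((hmp c).integrableOn_comp_preimage (hemb c)).2 hint
    rwa [hpre] at this
  have hsum : (Fintype.card Fq : ℂ) * ∫ x in s, f x ∂μ = 0 := by
    calc (Fintype.card Fq : ℂ) * ∫ x in s, f x ∂μ
      _ = ∑ c, ∫ x in s, f (h c + x) ∂μ := by simp [htrans]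
      _ = ∫ x in s, ∑ c, f (h c + x) ∂μ := (integral_finsetSum _ fun c _ ↦ hint' c).symm
      _ = ∫ x in s, 0 ∂μ := setIntegral_congr_fun hs fun x hx ↦ by
          simp [hf x hx, ← Finset.mul_sum, hw x hx]
      _ = 0 := by simp
  exact (mul_eq_zero.1 hsum).resolve_left (by simp)

/-! ### Leading coefficients of quotients -/

theorem order_div_Kinf {Fq : Type} [Field Fq] {x y : Kinf Fq} (hx : x ≠ 0) (hy : y ≠ 0) :
    (x / y).order = x.order - y.order := by
  have := HahnSeries.order_mul (div_ne_zero hx hy) hy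
  rw [div_mul_cancel₀ _ hy] at this
  omega

theorem leadingCoeff_div_Kinf {Fq : Type} [Field Fq] (x : Kinf Fq) {y : Kinf Fq} (hy : y ≠ 0) :
    (x / y).leadingCoeff = x.leadingCoeff / y.leadingCoeff := by
  rw [eq_div_iff (HahnSeries.leadingCoeff_ne_zero.2 hy), ← HahnSeries.leadingCoeff_mul,
    div_mul_cancel₀ _ hy]

theorem psiK_add (x y : Kinf Fq) : psiK Fq (x + y) = psiK Fq x * psiK Fq y := by
  simp [psiK, eFq_add]

theorem psiK_of_one_lt_order {x : Kinf Fq} (hx : 1 < x.order) : psiK Fq x = 1 := by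
  rw [psiK, HahnSeries.coeff_eq_zero_of_lt_order hx, eFq_zero]

theorem psiK_of_order_eq_one {Fq : Type} [Field Fq] {x : Kinf Fq} (hx : x.order = 1) :
    psiK Fq x = eFq Fq x.leadingCoeff := by
  rw [psiK, HahnSeries.leadingCoeff_eq, hx]

/-- A perturbation of size less than `q^a` preserves the sphere `|x| = q^a`. -/
theorem single_add_mem_sphereK_iff {a m : ℤ} (hm : -a < m) (c : Fq) (x : Kinf Fq) :
    HahnSeries.single m c + x ∈ sphereK Fq a ↔ x ∈ sphereK Fq a := by
  have h (i : ℤ) (hi : i ≤ -a) : (HahnSeries.single m c + x).coeff i = x.coeff i := by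
    rw [HahnSeries.coeff_add, HahnSeries.coeff_single_of_ne (by omega), zero_add]
  simp only [mem_sphereK, h _ le_rfl]
  refine and_congr_right fun _ ↦ forall₂_congr fun i hi ↦ ?_
  rw [h i hi.le]

theorem leadingCoeff_of_mem_sphereK {a : ℤ} {x : Kinf Fq} (hx : x ∈ sphereK Fq a) :
    x.leadingCoeff = x.coeff (-a) := by
  rw [HahnSeries.leadingCoeff_eq, (absK_eq_zpow_iff.1 hx).2]

/-- The effect on `α / x` of adding to `x` a term smaller than `x`. -/
theorem div_single_add {a m : ℤ} (hm : -a < m) {α x : Kinf Fq} (hα : α ≠ 0)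
    (hx : x ∈ sphereK Fq a) {c : Fq} (hc : c ≠ 0) :
    ∃ z : Kinf Fq, α / (HahnSeries.single m c + x) = α / x + z ∧
      z.order = α.order + m + 2 * a ∧
      z.leadingCoeff = c * (-(α.leadingCoeff / x.leadingCoeff ^ 2)) := by
  set h : Kinf Fq := HahnSeries.single m c with hh
  have hy : h + x ∈ sphereK Fq a := (single_add_mem_sphereK_iff hm c x).2 hx
  have hylead : (h + x).leadingCoeff = x.leadingCoeff := by
    rw [leadingCoeff_of_mem_sphereK hx, leadingCoeff_of_mem_sphereK hy, HahnSeries.coeff_add,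
      HahnSeries.coeff_single_of_ne (by omega), zero_add]
  obtain ⟨hx0, hxo⟩ := absK_eq_zpow_iff.1 hx
  obtain ⟨hy0, hyo⟩ := absK_eq_zpow_iff.1 hy
  have hh0 : h ≠ 0 := HahnSeries.single_ne_zero hc
  refine ⟨-(α * h / (x * (h + x))), by field_simp; ring, ?_, ?_⟩
  · rw [HahnSeries.order_neg, order_div_Kinf (mul_ne_zero hα hh0) (mul_ne_zero hx0 hy0),
      HahnSeries.order_mul hα hh0, HahnSeries.order_mul hx0 hy0, hxo, hyo, hh,
      HahnSeries.order_single hc]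
    ring
  · rw [HahnSeries.leadingCoeff_neg, leadingCoeff_div_Kinf _ (mul_ne_zero hx0 hy0),
      HahnSeries.leadingCoeff_mul, HahnSeries.leadingCoeff_mul, hylead, hh,
      HahnSeries.leadingCoeff_of_single]
    ring

variable {a b : ℤ} {α : Kinf Fq}

theorem IsHaar.integral_of_max_lt (hμ : IsHaar Fq μ) (hα : α ≠ 0)
    (hord : α.order = -(2 * a + b)) (h : max (a + b) a < -1) :
    ∫ x in sphereK Fq a, psiK Fq (α / x + x) ∂μ =
      ((Fintype.card Fq : ℂ) - 1) * (Fintype.card Fq : ℂ) ^ a := by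
  rw [hμ.setIntegral_sphereK_of_leadingCoeff (g := fun _ ↦ 1)]
  · simp [Finset.card_erase_of_mem, Nat.cast_sub Fintype.card_pos]
  · intro x hx
    obtain ⟨hx0, hxo⟩ := absK_eq_zpow_iff.1 hx
    rw [psiK_add, psiK_of_one_lt_order (x := x) (by omega), psiK_of_one_lt_order, mul_one]
    rw [order_div_Kinf hα hx0]
    omega

theorem IsHaar.integral_of_max_eq (hμ : IsHaar Fq μ) (hb : b ≠ 0) (hα : α ≠ 0)
    (hord : α.order = -(2 * a + b)) (h : max (a + b) a = -1) :
    ∫ x in sphereK Fq a, psiK Fq (α / x + x) ∂μ = -(Fintype.card Fq : ℂ) ^ a := by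
  rcases hb.lt_or_gt with hb | hb
  · rw [hμ.setIntegral_sphereK_of_leadingCoeff (g := eFq Fq), sum_eFq_erase_zero, neg_one_mul]
    intro x hx
    obtain ⟨hx0, hxo⟩ := absK_eq_zpow_iff.1 hx
    rw [psiK_add, psiK_of_order_eq_one (x := x) (by omega), psiK_of_one_lt_order, one_mul,
      leadingCoeff_of_mem_sphereK hx]
    rw [order_div_Kinf hα hx0]
    omega
  · rw [hμ.setIntegral_sphereK_of_leadingCoeff (g := fun c ↦ eFq Fq (α.leadingCoeff / c)),
      sum_eFq_div_erase_zero (HahnSeries.leadingCoeff_ne_zero.2 hα), neg_one_mul]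
    intro x hx
    obtain ⟨hx0, hxo⟩ := absK_eq_zpow_iff.1 hx
    rw [psiK_add, psiK_of_one_lt_order (x := x) (by omega), psiK_of_order_eq_one, mul_one,
      leadingCoeff_div_Kinf _ hx0, leadingCoeff_of_mem_sphereK hx]
    rw [order_div_Kinf hα hx0]
    omega

theorem IsHaar.integral_of_lt_max (hμ : IsHaar Fq μ) (hb : b ≠ 0) (hα : α ≠ 0)
    (hord : α.order = -(2 * a + b)) (h : -1 < max (a + b) a) :
    ∫ x in sphereK Fq a, psiK Fq (α / x + x) ∂μ = 0 := by
  rcases hb.lt_or_gt with hb | hb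
  · have hm : -a < 1 := by omega
    refine hμ.setIntegral_eq_zero_of_sum_translate (measurableSet_sphereK a)
      (h := HahnSeries.single 1) (w := fun _ c ↦ eFq Fq c)
      (single_add_mem_sphereK_iff hm) (fun x hx c ↦ ?_) fun _ _ ↦ sum_eFq
    rcases eq_or_ne c 0 with rfl | hc
    · simp [eFq_zero]
    obtain ⟨z, hz, hzo, -⟩ := div_single_add hm hα hx hc
    have hs : psiK Fq (HahnSeries.single 1 c) = eFq Fq c := by simp [psiK]
    rw [hz]
    simp only [psiK_add, psiK_of_one_lt_order (x := z) (by omega), hs]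
    ring
  · have hm : -a < 1 + b := by omega
    refine hμ.setIntegral_eq_zero_of_sum_translate (measurableSet_sphereK a)
      (h := HahnSeries.single (1 + b))
      (w := fun x c ↦ eFq Fq (c * (-(α.leadingCoeff / x.leadingCoeff ^ 2))))
      (single_add_mem_sphereK_iff hm) (fun x hx c ↦ ?_) fun x hx ↦ sum_eFq_mul ?_
    · rcases eq_or_ne c 0 with rfl | hc
      · simp [eFq_zero]
      obtain ⟨z, hz, hzo, hzl⟩ := div_single_add hm hα hx hc
      have hs : psiK Fq (HahnSeries.single (1 + b) c) = 1 :=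
        psiK_of_one_lt_order (by rw [HahnSeries.order_single hc]; omega)
      rw [hz]
      simp only [psiK_add, psiK_of_order_eq_one (x := z) (by omega), hs, hzl]
      ring
    · simp [hα, (absK_eq_zpow_iff.1 hx).1]

end Auxiliary

end

noncomputable section

variable (Fq : Type) [Field Fq] [Fintype Fq]

/-- **Values of `B_∞(ψ,a,α)` off the critical circle.** If `|α| = q^{2a+b}` with `b ≠ 0`,
then `∫_{|x| = q^a} ψ(α/x + x) dμ` equals `(q−1)q^a`, `−q^a` or `0` according as
`max(a+b,a)` is `< −1`, `= −1` or `> −1`. -/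
theorem stmt_19 (μ : @MeasureTheory.Measure (Kinf Fq) (KinfMS Fq)) (hμ : IsHaar Fq μ)
    (a b : ℤ) (hb : b ≠ 0) (α : Kinf Fq) (hα : α ≠ 0)
    (habs : absK Fq α = (Fintype.card Fq : ℝ) ^ (2 * a + b)) :
    (max (a + b) a < -1 →
      (letI := KinfMS Fq
        ∫ x in {x : Kinf Fq | absK Fq x = (Fintype.card Fq : ℝ) ^ a},
          psiK Fq (α / x + x) ∂μ) = ((Fintype.card Fq : ℂ) - 1) * (Fintype.card Fq : ℂ) ^ a) ∧
    (max (a + b) a = -1 →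
      (letI := KinfMS Fq
        ∫ x in {x : Kinf Fq | absK Fq x = (Fintype.card Fq : ℝ) ^ a},
          psiK Fq (α / x + x) ∂μ) = -((Fintype.card Fq : ℂ) ^ a)) ∧
    (-1 < max (a + b) a →
      (letI := KinfMS Fq
        ∫ x in {x : Kinf Fq | absK Fq x = (Fintype.card Fq : ℝ) ^ a},
          psiK Fq (α / x + x) ∂μ) = 0) := by
  have hord : α.order = -(2 * a + b) := (absK_eq_zpow_iff.1 habs).2
  exact ⟨hμ.integral_of_max_lt hα hord, hμ.integral_of_max_eq hb hα hord,
    hμ.integral_of_lt_max hb hα hord⟩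

end
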